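/- arXiv:2507.11463 — 2 statements merged into one kernel-verified Lean document; each statement's English description precedes it below -/
import Mathlib

section
/- Let m, t, l be positive integers with t + l = m. Let r⁺(x) and r⁻(x) be monic real polynomials of degree t such that r⁺ − r⁻ has degree exactly l. Suppose there are real numbers c_1 < c_2 < ⋯ < c_{m+1} such that r⁺(c_i) = 0 for every even i and r⁻(c_i) = 0 for every odd i (1 ≤ i ≤ m+1). Then every complex root of r⁺ and of r⁻ is real; every root of r⁺ not among {c_i : i even} and every root of r⁻ not among {c_i : i odd} lies in the open interval (c_1, c_{m+1}); and these remaining roots (of r⁺ and r⁻ taken together, with multiplicity) are pairwise distinct. -/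
open Polynomial

section AlternatingNodes

variable {ι : Type*}

theorem nodal_dvd_of_eval_eq_zero {B : Finset ι} {c : ι → ℝ} (hc : Set.InjOn c B)
    {f : ℝ[X]} (hf : ∀ i ∈ B, f.eval (c i) = 0) : Lagrange.nodal B c ∣ f := by
  refine Finset.prod_dvd_of_coprime (fun i hi j hj hij => ?_) fun i hi =>
    dvd_iff_isRoot.2 (hf i hi)
  exact pairwise_coprime_X_sub_C (K := ℝ) (s := id) Function.injective_id
    (fun h => hij (hc hi hj h))

theorem roots_nodal (B : Finset ι) (c : ι → ℝ) :
    (Lagrange.nodal B c).roots = B.val.map c := by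
  rw [← roots_multiset_prod_X_sub_C (B.val.map c), Multiset.map_map]
  rfl

variable [DecidableEq ι]

/-- A polynomial of degree less than `#s - 1` has vanishing divided difference over `s`. -/
theorem sum_eval_div_prod_sub_eq_zero {s : Finset ι} {c : ι → ℝ} (hc : Set.InjOn c s)
    {p : ℝ[X]} (hp : p.natDegree + 1 < s.card) :
    ∑ i ∈ s, p.eval (c i) / ∏ j ∈ s.erase i, (c i - c j) = 0 := by
  rw [← Lagrange.coeff_eq_sum hc
    (degree_le_natDegree.trans_lt (by exact_mod_cast (by omega : p.natDegree < s.card)))]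
  exact coeff_eq_zero_of_natDegree_lt (by omega)

/-- If `f` and `g` vanish on complementary sets of nodes, a factorisation `f = nodal * (h * q)`
with `h` nonnegative on the nodes in `A` and `q` of small degree is only possible for `f = 0`. -/
theorem eq_zero_of_factor_nonneg {s A : Finset ι} (hA : A ⊆ s) {c : ι → ℝ}
    (hc : Set.InjOn c s) {σ : ℝ}
    (hσ : ∀ i ∈ A, 0 < σ * ∏ j ∈ s.erase i, (c i - c j)) {f g h q : ℝ[X]}
    (hg : ∀ i ∈ A, g.eval (c i) = 0) (hf : f = Lagrange.nodal (s \ A) c * (h * q))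
    (hh : ∀ i ∈ A, 0 ≤ h.eval (c i))
    (hdeg : (g - f).natDegree + ((s \ A).card + q.natDegree) + 1 < s.card)
    (hfdeg : f.natDegree < s.card) : f = 0 := by
  set Q := Lagrange.nodal (s \ A) c with hQ
  have hG : ((g - f) * (Q * q)).natDegree + 1 < s.card := by
    have h1 := natDegree_mul_le (p := g - f) (q := Q * q)
    have h2 := natDegree_mul_le (p := Q) (q := q)
    have h3 : Q.natDegree = (s \ A).card := Lagrange.natDegree_nodal
    omega
  have hQ0 : ∀ i ∈ s \ A, Q.eval (c i) = 0 := fun i hi => Lagrange.eval_nodal_at_node hi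
  have hval : ∀ i ∈ A, ((g - f) * (Q * q)).eval (c i) =
      -(h.eval (c i) * (Q.eval (c i) * q.eval (c i)) ^ 2) := by
    intro i hi
    simp only [eval_mul, eval_sub, hg i hi, hf]
    ring
  have hsum := sum_eval_div_prod_sub_eq_zero hc hG
  rw [← Finset.sum_subset hA (fun i hi hiA => by
    simp [hQ0 i (Finset.mem_sdiff.2 ⟨hi, hiA⟩)])] at hsum
  have hsum' : ∑ i ∈ A, (h.eval (c i) * (Q.eval (c i) * q.eval (c i)) ^ 2) /
      (σ * ∏ j ∈ s.erase i, (c i - c j)) = 0 := by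
    have : ∑ i ∈ A, (h.eval (c i) * (Q.eval (c i) * q.eval (c i)) ^ 2) /
        (σ * ∏ j ∈ s.erase i, (c i - c j)) = -σ⁻¹ * ∑ i ∈ A,
          ((g - f) * (Q * q)).eval (c i) / ∏ j ∈ s.erase i, (c i - c j) := by
      rw [Finset.mul_sum]
      refine Finset.sum_congr rfl fun i hi => ?_
      rw [hval i hi, div_mul_eq_div_div]
      ring
    rw [this, hsum, mul_zero]
  rw [Finset.sum_eq_zero_iff_of_nonneg fun i hi =>
    div_nonneg (mul_nonneg (hh i hi) (sq_nonneg _)) (hσ i hi).le] at hsum'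
  refine Polynomial.eq_zero_of_degree_lt_of_eval_index_eq_zero s hc
    (degree_le_natDegree.trans_lt (by exact_mod_cast hfdeg)) fun i hi => ?_
  rw [hf]
  by_cases hiA : i ∈ A
  · have := (div_eq_zero_iff.1 (hsum' i hiA)).resolve_right (hσ i hiA).ne'
    rcases mul_eq_zero.1 this with h0 | h0
    · simp [h0]
    · have h1 := pow_eq_zero_iff (two_ne_zero) |>.1 h0
      simp only [eval_mul]
      linear_combination h.eval (c i) * h1
  · simp [hQ0 i (Finset.mem_sdiff.2 ⟨hi, hiA⟩)]

/-- The roots of the cofactor `b` of `f` are real, simple and lie strictly between any two bounds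
for the nodes in `A`. -/
theorem cofactor_roots {s A : Finset ι} (hA : A ⊆ s) {c : ι → ℝ}
    (hc : Set.InjOn c s) {σ : ℝ}
    (hσ : ∀ i ∈ A, 0 < σ * ∏ j ∈ s.erase i, (c i - c j)) {f g b : ℝ[X]}
    (hg : ∀ i ∈ A, g.eval (c i) = 0) (hf : f = Lagrange.nodal (s \ A) c * b)
    (hf0 : f ≠ 0) (hdeg : (g - f).natDegree + f.natDegree + 1 = s.card) {lo hi : ℝ}
    (hlo : ∀ i ∈ A, lo ≤ c i) (hhi : ∀ i ∈ A, c i ≤ hi) :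
    (∀ z : ℂ, aeval z f = 0 → z.im = 0) ∧ (∀ x ∈ b.roots, x ∈ Set.Ioo lo hi) ∧
      b.roots.Nodup := by
  have hb0 : b ≠ 0 := by rintro rfl; simp at hf; exact hf0 hf
  have hfd : f.natDegree = (s \ A).card + b.natDegree := by
    rw [hf, natDegree_mul Lagrange.nodal_ne_zero hb0, Lagrange.natDegree_nodal]
  have key : ∀ h q : ℝ[X], b = h * q → 0 < h.natDegree → ¬ ∀ i ∈ A, 0 ≤ h.eval (c i) := by
    intro h q hbq hh hpos
    have h0 : h ≠ 0 := by rintro rfl; simp at hh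
    have q0 : q ≠ 0 := by rintro rfl; simp at hbq; exact hb0 hbq
    have := natDegree_mul h0 q0
    rw [← hbq] at this
    exact hf0 (eq_zero_of_factor_nonneg hA hc hσ hg (hbq ▸ hf) hpos (by omega) (by omega))
  refine ⟨fun z hz => ?_, fun x hx => ?_, ?_⟩
  · by_contra him
    have hbz : aeval z b = 0 := by
      rw [hf, map_mul] at hz
      refine (mul_eq_zero.1 hz).resolve_left fun hQ => ?_
      rw [Lagrange.nodal, map_prod, Finset.prod_eq_zero_iff] at hQ
      obtain ⟨i, -, hi⟩ := hQ
      apply him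
      have : z = (c i : ℂ) := by simpa [sub_eq_zero] using hi
      simp [this]
    obtain ⟨q, hq⟩ := b.quadratic_dvd_of_aeval_eq_zero_im_ne_zero hbz him
    refine key _ q hq ?_ fun i _ => ?_
    · have : (X ^ 2 - C (2 * z.re) * X + C (‖z‖ ^ 2) : ℝ[X]).natDegree = 2 := by
        compute_degree!
      omega
    · simp only [eval_add, eval_sub, eval_pow, eval_X, eval_mul, eval_C]
      rw [← Complex.normSq_eq_norm_sq, Complex.normSq_apply]
      nlinarith [sq_nonneg (c i - z.re), sq_nonneg z.im]
  · obtain ⟨q, hq⟩ := dvd_iff_isRoot.2 (isRoot_of_mem_roots hx)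
    constructor
    · by_contra hlt
      refine key _ q hq (by simp) fun i hi => ?_
      have := hlo i hi
      simp only [eval_sub, eval_X, eval_C]
      linarith
    · by_contra hlt
      refine key (-(X - C x)) (-q) (by rw [hq]; ring) (by rw [natDegree_neg]; simp)
        fun i hi => ?_
      have := hhi i hi
      simp only [eval_neg, eval_sub, eval_X, eval_C]
      linarith
  · rw [Multiset.nodup_iff_count_le_one]
    intro x
    by_contra! hlt
    rw [count_roots] at hlt
    obtain ⟨q, hq⟩ := (le_rootMultiplicity_iff hb0).1 (show 2 ≤ _ from hlt)
    refine key _ q hq (by simp) fun i _ => ?_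
    simp only [eval_pow]
    positivity

/-- The cofactors of `f` and `g` have no common root. -/
theorem disjoint_cofactor_roots {s A : Finset ι} (hA : A ⊆ s) {c : ι → ℝ}
    (hc : Set.InjOn c s) {σ : ℝ}
    (hσ : ∀ i ∈ A, 0 < σ * ∏ j ∈ s.erase i, (c i - c j)) {f g a b : ℝ[X]}
    (hg : g = Lagrange.nodal A c * a) (hf : f = Lagrange.nodal (s \ A) c * b)
    (hf0 : f ≠ 0) (hd : g - f ≠ 0) (hdeg : (g - f).natDegree + f.natDegree + 1 = s.card) :
    Disjoint a.roots b.roots := by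
  rw [Multiset.disjoint_left]
  intro x hxa hxb
  obtain ⟨a', ha⟩ := dvd_iff_isRoot.2 (isRoot_of_mem_roots hxa)
  obtain ⟨b', hb⟩ := dvd_iff_isRoot.2 (isRoot_of_mem_roots hxb)
  set f' := Lagrange.nodal (s \ A) c * b' with hf'
  set g' := Lagrange.nodal A c * a' with hg'
  have hff : f = (X - C x) * f' := by rw [hf, hb, hf']; ring
  have hdd : g - f = (X - C x) * (g' - f') := by rw [hff, hg, ha, hg']; ring
  have hf0' : f' ≠ 0 := fun h => hf0 (by rw [hff, h, mul_zero])
  have hd0' : g' - f' ≠ 0 := fun h => hd (by rw [hdd, h, mul_zero])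
  have hb0' : b' ≠ 0 := fun h => hf0' (by rw [hf', h, mul_zero])
  have h1 : f.natDegree = 1 + f'.natDegree := by
    rw [hff, natDegree_mul (X_sub_C_ne_zero x) hf0', natDegree_X_sub_C]
  have h2 : (g - f).natDegree = 1 + (g' - f').natDegree := by
    rw [hdd, natDegree_mul (X_sub_C_ne_zero x) hd0', natDegree_X_sub_C]
  have h3 : f'.natDegree = (s \ A).card + b'.natDegree := by
    rw [hf', natDegree_mul Lagrange.nodal_ne_zero hb0', Lagrange.natDegree_nodal]
  refine hf0' (eq_zero_of_factor_nonneg (g := g') (h := 1) (q := b') hA hc hσ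
    (fun i hi => ?_) (by rw [one_mul]) (by simp) (by omega) (by omega))
  rw [hg', eval_mul, Lagrange.eval_nodal_at_node hi, zero_mul]

end AlternatingNodes

theorem neg_one_pow_mul_prod_sub_pos {n : ℕ} {c : ℕ → ℝ}
    (hc : ∀ i j, 1 ≤ i → i < j → j ≤ n → c i < c j) {i : ℕ} (hi : i ∈ Finset.Icc 1 n) :
    0 < (-1) ^ (n - i) * ∏ j ∈ (Finset.Icc 1 n).erase i, (c i - c j) := by
  obtain ⟨h1, hn⟩ := Finset.mem_Icc.1 hi
  have hsplit : (Finset.Icc 1 n).erase i = Finset.Ico 1 i ∪ Finset.Ioc i n := by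
    ext j
    simp only [Finset.mem_erase, Finset.mem_Icc, Finset.mem_union, Finset.mem_Ico, Finset.mem_Ioc]
    omega
  have hdisj : Disjoint (Finset.Ico 1 i) (Finset.Ioc i n) := by
    rw [Finset.disjoint_left]
    intro j
    simp only [Finset.mem_Ico, Finset.mem_Ioc]
    omega
  have hneg : (-1 : ℝ) ^ (n - i) * ∏ j ∈ Finset.Ioc i n, (c i - c j) =
      ∏ j ∈ Finset.Ioc i n, (c j - c i) := by
    rw [← Nat.card_Ioc, ← Finset.prod_const, ← Finset.prod_mul_distrib]
    exact Finset.prod_congr rfl fun j _ => by ring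
  rw [hsplit, Finset.prod_union hdisj, mul_left_comm, hneg]
  refine mul_pos (Finset.prod_pos fun j hj => ?_) (Finset.prod_pos fun j hj => ?_)
  · rw [Finset.mem_Ico] at hj
    exact sub_pos.2 (hc j i hj.1 hj.2 hn)
  · rw [Finset.mem_Ioc] at hj
    exact sub_pos.2 (hc i j h1 hj.1 hj.2)

theorem remaining_roots_location (m t l : ℕ)
    (hm : 1 ≤ m) (ht : 1 ≤ t) (hl : 1 ≤ l) (htl : t + l = m)
    (rp rm : Polynomial ℝ) (hpmonic : rp.Monic) (hmmonic : rm.Monic)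
    (hpdeg : rp.natDegree = t) (hmdeg : rm.natDegree = t)
    (hdiff : (rp - rm).degree = (l : WithBot ℕ))
    (c : ℕ → ℝ) (hc : ∀ i j, 1 ≤ i → i < j → j ≤ m + 1 → c i < c j)
    (hpz : ∀ i, 1 ≤ i → i ≤ m + 1 → Even i → rp.eval (c i) = 0)
    (hmz : ∀ i, 1 ≤ i → i ≤ m + 1 → Odd i → rm.eval (c i) = 0) :
    (∀ z : ℂ, Polynomial.aeval z rp = 0 → z.im = 0) ∧
    (∀ z : ℂ, Polynomial.aeval z rm = 0 → z.im = 0) ∧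
    (∀ x ∈ (rp.roots - ((Finset.Icc 1 (m + 1)).filter (fun i => Even i)).val.map c) +
        (rm.roots - ((Finset.Icc 1 (m + 1)).filter (fun i => Odd i)).val.map c),
      x ∈ Set.Ioo (c 1) (c (m + 1))) ∧
    ((rp.roots - ((Finset.Icc 1 (m + 1)).filter (fun i => Even i)).val.map c) +
        (rm.roots - ((Finset.Icc 1 (m + 1)).filter (fun i => Odd i)).val.map c)).Nodup := by
  set s := Finset.Icc 1 (m + 1) with hs
  set E := s.filter (fun i => Even i) with hE
  set O := s.filter (fun i => Odd i) with hO
  have hEs : E ⊆ s := Finset.filter_subset _ _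
  have hOs : O ⊆ s := Finset.filter_subset _ _
  have hsE : s \ E = O := by ext i; simp [hE, hO]; tauto
  have hsO : s \ O = E := by ext i; simp [hE, hO]; tauto
  have hinj : Set.InjOn c s := by
    intro i hi j hj hij
    simp only [hs, Finset.coe_Icc, Set.mem_Icc] at hi hj
    rcases lt_trichotomy i j with h | h | h
    · exact absurd hij (hc i j hi.1 h hj.2).ne
    · exact h
    · exact absurd hij (hc j i hj.1 h hi.2).ne'
  have hbd : ∀ i ∈ s, c 1 ≤ c i ∧ c i ≤ c (m + 1) := by
    intro i hi
    obtain ⟨h1, h2⟩ := Finset.mem_Icc.1 hi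
    constructor
    · rcases h1.eq_or_lt with h | h
      · rw [← h]
      · exact (hc 1 i le_rfl h h2).le
    · rcases h2.eq_or_lt with h | h
      · rw [h]
      · exact (hc i (m + 1) h1 h le_rfl).le
  have hpE : ∀ i ∈ E, rp.eval (c i) = 0 := fun i hi => by
    obtain ⟨h, he⟩ := Finset.mem_filter.1 hi
    obtain ⟨h1, h2⟩ := Finset.mem_Icc.1 h
    exact hpz i h1 h2 he
  have hmO : ∀ i ∈ O, rm.eval (c i) = 0 := fun i hi => by
    obtain ⟨h, he⟩ := Finset.mem_filter.1 hi
    obtain ⟨h1, h2⟩ := Finset.mem_Icc.1 h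
    exact hmz i h1 h2 he
  have hσE : ∀ i ∈ E, 0 < (-1 : ℝ) ^ (m + 1) * ∏ j ∈ s.erase i, (c i - c j) := fun i hi => by
    obtain ⟨h, he⟩ := Finset.mem_filter.1 hi
    have hpos := neg_one_pow_mul_prod_sub_pos hc h
    have hpow : (-1 : ℝ) ^ (m + 1) = (-1) ^ (m + 1 - i) * (-1) ^ i := by
      rw [← pow_add, Nat.sub_add_cancel (Finset.mem_Icc.1 h).2]
    rwa [hpow, he.neg_one_pow, mul_one]
  have hσO : ∀ i ∈ O, 0 < (-1 : ℝ) ^ m * ∏ j ∈ s.erase i, (c i - c j) := fun i hi => by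
    obtain ⟨h, he⟩ := Finset.mem_filter.1 hi
    have hpos := neg_one_pow_mul_prod_sub_pos hc h
    have hpow : (-1 : ℝ) ^ (m + 1) = (-1) ^ (m + 1 - i) * (-1) ^ i := by
      rw [← pow_add, Nat.sub_add_cancel (Finset.mem_Icc.1 h).2]
    rw [he.neg_one_pow, pow_succ] at hpow
    rwa [show (-1 : ℝ) ^ m = (-1) ^ (m + 1 - i) by linarith]
  obtain ⟨a, ha⟩ := nodal_dvd_of_eval_eq_zero (hinj.mono (by exact_mod_cast hEs)) hpE
  obtain ⟨b, hb⟩ := nodal_dvd_of_eval_eq_zero (hinj.mono (by exact_mod_cast hOs)) hmO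
  have hra : rp.roots - E.val.map c = a.roots := by
    have h := roots_mul (ha ▸ hpmonic.ne_zero)
    rw [← ha, roots_nodal] at h
    rw [h, add_tsub_cancel_left]
  have hrb : rm.roots - O.val.map c = b.roots := by
    have h := roots_mul (hb ▸ hmmonic.ne_zero)
    rw [← hb, roots_nodal] at h
    rw [h, add_tsub_cancel_left]
  have hdn : (rp - rm).natDegree = l := natDegree_eq_of_degree_eq_some hdiff
  have hd0 : rp - rm ≠ 0 := fun h => by simp [h] at hdiff
  have hdn' : (rm - rp).natDegree = l := by rw [← neg_sub, natDegree_neg, hdn]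
  have hcard : s.card = m + 1 := by simp [hs]
  obtain ⟨hm1, hm2, hm3⟩ := cofactor_roots hEs hinj hσE hpE (hsE.symm ▸ hb) hmmonic.ne_zero
    (by omega) (fun i hi => (hbd i (hEs hi)).1) (fun i hi => (hbd i (hEs hi)).2)
  obtain ⟨hp1, hp2, hp3⟩ := cofactor_roots hOs hinj hσO hmO (hsO.symm ▸ ha) hpmonic.ne_zero
    (by omega) (fun i hi => (hbd i (hOs hi)).1) (fun i hi => (hbd i (hOs hi)).2)
  have hdis := disjoint_cofactor_roots hEs hinj hσE ha (hsE.symm ▸ hb) hmmonic.ne_zero hd0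
    (by omega)
  rw [hra, hrb]
  refine ⟨hp1, hm1, fun x hx => ?_, Multiset.nodup_add.2 ⟨hp3, hm3, hdis⟩⟩
  exact (Multiset.mem_add.1 hx).elim (hp2 x) (hm2 x)
end

section
/- Let n ≥ 2, let b_1, …, b_{n+1} be distinct real numbers, and let a_1, …, a_{n+1} be real numbers satisfying Σ_{k=1}^{n+1} a_k = 0 and Σ_{k=1}^{n+1} a_k·b_k = 0. Then there exists a function f : ℝ → ℝ that is additive (f(x + y) = f(x) + f(y) for all x, y ∈ ℝ), is not of the form f(x) = c·x for any constant c ∈ ℝ, and satisfies Σ_{k=1}^{n+1} a_k·f(c + b_k·h) = 0 for all c, h ∈ ℝ. -/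
/-- A proper subfield `K` of `ℝ` admits a nonzero `K`-linear map `ℝ → K` killing `1`;
regarded as a real function it is `K`-linear but not `ℝ`-linear. -/
theorem Subfield.exists_linearMap_not_mul (K : Subfield ℝ) (hK : K ≠ ⊤) :
    ∃ f : ℝ →ₗ[K] K, ¬ ∃ c : ℝ, ∀ x : ℝ, (f x : ℝ) = c * x := by
  obtain ⟨x, hx⟩ : ∃ x, x ∉ K := by
    simpa [SetLike.ext_iff] using hK
  have hx' : x ∉ Submodule.span K {(1 : ℝ)} := by
    rw [Submodule.mem_span_singleton]
    rintro ⟨a, rfl⟩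
    exact hx (by simp [Subfield.smul_def])
  obtain ⟨f, hfx, hf⟩ := Submodule.exists_le_ker_of_notMem hx'
  refine ⟨f, fun ⟨c, hc⟩ => hfx ?_⟩
  have hf1 : f 1 = 0 := hf (Submodule.mem_span_singleton_self 1)
  have hc0 : c = 0 := by simpa [hf1] using (hc 1).symm
  exact Subtype.ext (by simpa [hc0] using hc x)

/-- The subfield of `ℝ` generated by a countable set is proper. -/
theorem Subfield.closure_ne_top_of_countable {s : Set ℝ} (hs : s.Countable) :
    Subfield.closure s ≠ ⊤ := by
  intro h
  have hle : Cardinal.mk (Subfield.closure s) ≤ Cardinal.aleph0 :=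
    (Subfield.cardinalMk_closure_le_max s).trans (max_le hs.le_aleph0 le_rfl)
  refine Cardinal.not_countable_real (Cardinal.le_aleph0_iff_set_countable.mp ?_)
  rw [h] at hle
  exact hle

theorem nonlinear_additive_with_vanishing_difference (n : ℕ) (hn : 2 ≤ n)
    (b : Fin (n + 1) → ℝ) (hb : Function.Injective b)
    (a : Fin (n + 1) → ℝ)
    (h0 : ∑ k, a k = 0) (h1 : ∑ k, a k * b k = 0) :
    ∃ f : ℝ → ℝ,
      (∀ x y : ℝ, f (x + y) = f x + f y) ∧
      (¬ ∃ c : ℝ, ∀ x : ℝ, f x = c * x) ∧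
      (∀ c h : ℝ, ∑ k, a k * f (c + b k * h) = 0) := by
  obtain ⟨f, hf⟩ := Subfield.exists_linearMap_not_mul _
    (Subfield.closure_ne_top_of_countable (Set.countable_range b))
  refine ⟨fun x => f x, fun x y => by simp, hf, fun c h => ?_⟩
  have key (k) : (f (c + b k * h) : ℝ) = f c + b k * f h := by
    have hk : b k ∈ Subfield.closure (Set.range b) :=
      Subfield.subset_closure (Set.mem_range_self k)
    have := f.map_smul ⟨b k, hk⟩ h
    rw [Subfield.smul_def] at this
    simp only [smul_eq_mul] at this
    simp [this]
  calc ∑ k, a k * (f (c + b k * h) : ℝ)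
      = (∑ k, a k) * f c + (∑ k, a k * b k) * f h := by
        simp only [key, mul_add, Finset.sum_add_distrib, Finset.sum_mul, mul_assoc]
    _ = 0 := by rw [h0, h1]; ring
end
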